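/- For every nonempty finite subset T of a finite type U and all distinct x, y ∈ U, the expected signed outcome of the pair query satisfies |⟨v₊, ψ_T⟩|² − |⟨v₋, ψ_T⟩|² = 2/|T| if {x, y} ⊆ T, and |⟨v₊, ψ_T⟩|² − |⟨v₋, ψ_T⟩|² = 0 otherwise. -/

import Mathlib

open scoped InnerProductSpace

/-- `ψ_T = (1/√|T|) · ∑_{t∈T} e_t` in `ℂ^U`. -/
noncomputable def psi {U : Type*} [Fintype U] [DecidableEq U] (T : Finset U) :
    EuclideanSpace ℂ U :=
  ((Real.sqrt T.card : ℂ))⁻¹ • ∑ t ∈ T, EuclideanSpace.single t (1 : ℂ)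

/-- `v₊ = (e_x + e_y)/√2`. -/
noncomputable def vplus {U : Type*} [Fintype U] [DecidableEq U] (x y : U) :
    EuclideanSpace ℂ U :=
  ((Real.sqrt 2 : ℂ))⁻¹ • (EuclideanSpace.single x (1 : ℂ) + EuclideanSpace.single y (1 : ℂ))

/-- `v₋ = (e_x − e_y)/√2`. -/
noncomputable def vminus {U : Type*} [Fintype U] [DecidableEq U] (x y : U) :
    EuclideanSpace ℂ U :=
  ((Real.sqrt 2 : ℂ))⁻¹ • (EuclideanSpace.single x (1 : ℂ) - EuclideanSpace.single y (1 : ℂ))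

theorem psi_apply {U : Type*} [Fintype U] [DecidableEq U] (T : Finset U) (u : U) :
    psi T u = (((if u ∈ T then (Real.sqrt T.card)⁻¹ else 0 : ℝ)) : ℂ) := by
  by_cases h : u ∈ T <;> simp [psi, Finset.sum_apply, Pi.single_apply, h]

theorem inner_vplus {U : Type*} [Fintype U] [DecidableEq U] (x y : U)
    (v : EuclideanSpace ℂ U) :
    ⟪vplus x y, v⟫_ℂ = ((Real.sqrt 2 : ℂ))⁻¹ * (v x + v y) := by
  simp [vplus, EuclideanSpace.inner_single_left]
  ring

theorem inner_vminus {U : Type*} [Fintype U] [DecidableEq U] (x y : U)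
    (v : EuclideanSpace ℂ U) :
    ⟪vminus x y, v⟫_ℂ = ((Real.sqrt 2 : ℂ))⁻¹ * (v x - v y) := by
  simp [vminus, EuclideanSpace.inner_single_left]
  ring

theorem norm_inner_vplus_sq_sub_norm_inner_vminus_sq {U : Type*} [Fintype U] [DecidableEq U]
    (x y : U) (v : EuclideanSpace ℂ U) {a b : ℝ} (hx : v x = a) (hy : v y = b) :
    ‖⟪vplus x y, v⟫_ℂ‖ ^ 2 - ‖⟪vminus x y, v⟫_ℂ‖ ^ 2 = 2 * a * b := by
  rw [inner_vplus, inner_vminus, hx, hy, ← Complex.ofReal_add, ← Complex.ofReal_sub,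
    ← Complex.ofReal_inv, ← Complex.ofReal_mul, ← Complex.ofReal_mul, Complex.norm_real,
    Complex.norm_real, Real.norm_eq_abs, Real.norm_eq_abs, sq_abs, sq_abs, mul_pow, mul_pow,
    inv_pow, Real.sq_sqrt zero_le_two]
  ring

/-- Expected signed outcome of the pair query:
`|⟨v₊, ψ_T⟩|² − |⟨v₋, ψ_T⟩|²` is `2/|T|` if `{x,y} ⊆ T` and `0` otherwise. -/
theorem inner_vpm_psi_signed {U : Type*} [Fintype U] [DecidableEq U] (T : Finset U)
    (hT : T.Nonempty) (x y : U) (hxy : x ≠ y) :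
    (x ∈ T ∧ y ∈ T →
        ‖⟪vplus x y, psi T⟫_ℂ‖ ^ 2 - ‖⟪vminus x y, psi T⟫_ℂ‖ ^ 2 = 2 / (T.card : ℝ)) ∧
      (¬(x ∈ T ∧ y ∈ T) →
        ‖⟪vplus x y, psi T⟫_ℂ‖ ^ 2 - ‖⟪vminus x y, psi T⟫_ℂ‖ ^ 2 = 0) := by
  rw [norm_inner_vplus_sq_sub_norm_inner_vminus_sq x y _ (psi_apply T x) (psi_apply T y)]
  refine ⟨fun ⟨hx, hy⟩ => ?_, fun h => ?_⟩
  · rw [if_pos hx, if_pos hy, mul_assoc, ← mul_inv, Real.mul_self_sqrt (Nat.cast_nonneg _),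
      div_eq_mul_inv]
  · rcases not_and_or.mp h with h | h <;> simp [h]
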